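/- Let d ≥ 1, let g be the Lie subalgebra of d×d complex matrices (with bracket [A,B] = AB − BA) spanned by E := Σ_{i=1}^{d-1} i·E_{i,i+1}, F := Σ_{i=1}^{d-1} (d−i)·E_{i+1,i}, H := Σ_{i=1}^{d} (d+1−2i)·E_{i,i}, and regard the space of d×d complex matrices as a g-module via the adjoint action A·L := AL − LA. For n = 1, …, d let V_n denote the g-submodule generated by E^{n−1}. Then the submodules V₁, …, V_d are linearly independent (their pairwise sums are direct) and their sum is the whole space of d×d matrices, i.e. the space of d×d complex matrices is the internal direct sum V₁ ⊕ V₂ ⊕ ⋯ ⊕ V_d. -/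

import Mathlib

open Matrix

/-- `E = ∑_{i=1}^{d-1} i · E_{i,i+1}` (1-based indices), written entrywise with
0-based indices: the `(a, a+1)` entry is `a+1`. -/
noncomputable def matE (d : ℕ) : Matrix (Fin d) (Fin d) ℂ :=
  Matrix.of fun a b => if (b : ℕ) = (a : ℕ) + 1 then (((a : ℕ) + 1 : ℕ) : ℂ) else 0

/-- `F = ∑_{i=1}^{d-1} (d-i) · E_{i+1,i}`: the `(b+1, b)` entry is `d - (b+1)`. -/
noncomputable def matF (d : ℕ) : Matrix (Fin d) (Fin d) ℂ :=
  Matrix.of fun a b => if (a : ℕ) = (b : ℕ) + 1 then ((d : ℂ) - (((b : ℕ) + 1 : ℕ) : ℂ)) else 0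

/-- `H = ∑_{i=1}^{d} (d+1-2i) · E_{i,i}`: the `(a, a)` entry is `d + 1 - 2(a+1)`. -/
noncomputable def matH (d : ℕ) : Matrix (Fin d) (Fin d) ℂ :=
  Matrix.of fun a b => if a = b then ((d : ℂ) + 1 - 2 * (((a : ℕ) + 1 : ℕ) : ℂ)) else 0

/-- The image `g = span_ℂ{E, F, H} = ρ^{(d)}(sl₂(ℂ))`. -/
noncomputable def gSpan (d : ℕ) : Submodule ℂ (Matrix (Fin d) (Fin d) ℂ) :=
  Submodule.span ℂ {matE d, matF d, matH d}

/-- The `g`-submodule of the `d×d` matrices (for the adjoint action `A·L = AL - LA`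
of `g = gSpan d`) generated by a matrix `X`: the smallest `ℂ`-subspace containing
`X` that is closed under `L ↦ A*L - L*A` for every `A ∈ g`. -/
noncomputable def adSubmodule (d : ℕ) (X : Matrix (Fin d) (Fin d) ℂ) :
    Submodule ℂ (Matrix (Fin d) (Fin d) ℂ) :=
  sInf {W | X ∈ W ∧ ∀ A ∈ gSpan d, ∀ L ∈ W, A * L - L * A ∈ W}

/-- A multiple of the Casimir operator of an `sl₂`-triple of endomorphisms. -/
def casimirOf {A : Type*} [Ring A] (e f h : A) : A :=
  4 * f * e + h * h + 2 * h

section Casimir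

variable {A : Type*} [Ring A] {e f h : A}

lemma commute_casimirOf_e (hef : e * f - f * e = h) (hhe : h * e - e * h = 2 * e) :
    Commute (casimirOf e f h) e := by
  have h₁ : e * f = f * e + h := by rw [← hef]; abel
  have h₂ : h * e = e * h + 2 * e := by rw [← hhe]; abel
  have h₃ : h * h * e = e * h * h + 4 * (e * h) + 4 * e := by
    rw [mul_assoc, h₂, mul_add, ← mul_assoc, h₂]
    simp only [mul_assoc, two_mul, mul_add, add_mul, h₂]
    noncomm_ring
  have h₄ : e * (f * e) = f * e * e + e * h + 2 * e := by
    rw [← mul_assoc, h₁, add_mul, h₂]; abel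
  rw [commute_iff_eq, casimirOf]
  linear_combination (norm := noncomm_ring) h₃ - 4 * h₄ + 2 * h₂

lemma commute_casimirOf_h (hhe : h * e - e * h = 2 * e) (hhf : h * f - f * h = -(2 * f)) :
    Commute (casimirOf e f h) h := by
  rw [commute_iff_eq, casimirOf]
  linear_combination (norm := noncomm_ring) (-4 * f) * hhe - 4 * hhf * e

lemma commute_casimirOf_f (hef : e * f - f * e = h) (hhf : h * f - f * h = -(2 * f)) :
    Commute (casimirOf e f h) f := by
  have h₁ : f * (e * f) = f * (f * e) + f * h := by rw [← hef]; noncomm_ring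
  have h₂ : h * f = f * h - 2 * f := by linear_combination (norm := noncomm_ring) hhf
  have h₃ : h * (h * f) = f * (h * h) - 4 * (f * h) + 4 * f := by
    linear_combination (norm := noncomm_ring) h * h₂ + h₂ * h - 2 * h₂
  rw [commute_iff_eq, casimirOf]
  linear_combination (norm := noncomm_ring) 4 * h₁ + h₃ + 2 * h₂

end Casimir

attribute [local instance] LieRing.ofAssociativeRing

section Relations

variable (d : ℕ)

lemma matE_mul_matF_apply (a b : Fin d) :
    (matE d * matF d) a b = if a = b then ((a : ℂ) + 1) * ((d : ℂ) - (a + 1)) else 0 := by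
  rw [mul_apply]
  simp only [matE, matF, of_apply]
  by_cases ha : (a : ℕ) + 1 < d
  · rw [Finset.sum_eq_single ⟨a + 1, ha⟩]
    · split_ifs with h₁ h₂ h₂ <;> simp_all [Fin.ext_iff]
    · intro c _ hc
      rw [if_neg (by simpa [Fin.ext_iff] using hc), zero_mul]
    · simp
  · have had : (d : ℂ) = a + 1 := by exact_mod_cast (by omega : d = a + 1)
    rw [Finset.sum_eq_zero]
    · simp [had]
    · intro c _
      rw [if_neg (by omega), zero_mul]

lemma matF_mul_matE_apply (a b : Fin d) :
    (matF d * matE d) a b = if a = b then (a : ℂ) * ((d : ℂ) - a) else 0 := by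
  rw [mul_apply]
  simp only [matE, matF, of_apply]
  rcases Nat.eq_zero_or_pos (a : ℕ) with ha | ha
  · rw [Finset.sum_eq_zero]
    · simp [ha]
    · intro c _
      rw [if_neg (by omega), zero_mul]
  · obtain ⟨k, hk⟩ := Nat.exists_eq_add_of_lt ha
    rw [zero_add] at hk
    rw [Finset.sum_eq_single ⟨k, by omega⟩]
    · simp only [hk, Fin.ext_iff, if_true, eq_comm (a := (b : ℕ))]
      split_ifs <;> push_cast <;> ring
    · intro c _ hc
      rw [if_neg (by simpa [Fin.ext_iff, hk, eq_comm] using hc), zero_mul]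
    · simp

lemma lie_matE_matF : ⁅matE d, matF d⁆ = matH d := by
  ext a b
  rw [Ring.lie_def, Matrix.sub_apply, matE_mul_matF_apply, matF_mul_matE_apply]
  simp only [matH, of_apply]
  split_ifs <;> push_cast <;> ring

lemma matH_eq_diagonal :
    matH d = diagonal fun a : Fin d => (d : ℂ) + 1 - 2 * (((a : ℕ) + 1 : ℕ) : ℂ) := rfl

lemma lie_matH_matE : ⁅matH d, matE d⁆ = 2 • matE d := by
  ext a b
  rw [Ring.lie_def, matH_eq_diagonal, Matrix.sub_apply, diagonal_mul, mul_diagonal]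
  simp only [matE, of_apply, Matrix.smul_apply]
  split_ifs with hab
  · rw [hab]; push_cast; simp only [nsmul_eq_mul]; push_cast; ring
  · simp

lemma lie_matH_matF : ⁅matH d, matF d⁆ = -(2 • matF d) := by
  ext a b
  rw [Ring.lie_def, matH_eq_diagonal, Matrix.sub_apply, diagonal_mul, mul_diagonal]
  simp only [matF, of_apply, Matrix.smul_apply, Matrix.neg_apply]
  split_ifs with hab
  · rw [hab]; push_cast; simp only [nsmul_eq_mul]; push_cast; ring
  · simp

lemma lie_matE_matE_pow (n : ℕ) : ⁅matE d, matE d ^ n⁆ = 0 := by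
  rw [Ring.lie_def, ← pow_succ', ← pow_succ, sub_self]

lemma lie_matH_matE_pow (n : ℕ) : ⁅matH d, matE d ^ n⁆ = (2 * n : ℂ) • matE d ^ n := by
  induction n with
  | zero => simp [Ring.lie_def]
  | succ n ih =>
    have hE := lie_matH_matE d
    rw [Ring.lie_def] at ih hE ⊢
    have : matH d * matE d ^ (n + 1) - matE d ^ (n + 1) * matH d =
        (matH d * matE d ^ n - matE d ^ n * matH d) * matE d +
          matE d ^ n * (matH d * matE d - matE d * matH d) := by
      rw [pow_succ]; noncomm_ring
    rw [this, ih, hE, smul_mul_assoc, mul_smul_comm, ← pow_succ, ← Nat.cast_smul_eq_nsmul ℂ,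
      ← add_smul]
    push_cast
    ring_nf

lemma matE_pow_apply_zero {d : ℕ} (hd : 0 < d) (n : ℕ) (b : Fin d) :
    (matE d ^ n) ⟨0, hd⟩ b = if (b : ℕ) = n then (n.factorial : ℂ) else 0 := by
  induction n generalizing b with
  | zero =>
    simp [one_apply, Fin.ext_iff, eq_comm]
  | succ n ih =>
    rw [pow_succ, mul_apply]
    simp only [ih, ite_mul, zero_mul]
    split_ifs with hb
    · rw [Finset.sum_eq_single ⟨n, by omega⟩]
      · simp [matE, hb, Nat.factorial_succ, mul_comm]
      · intro c _ hc
        rw [if_neg (by simpa [Fin.ext_iff] using hc)]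
      · simp
    · refine Finset.sum_eq_zero fun c _ => ?_
      split_ifs with hc
      · simp [matE, show (b : ℕ) ≠ c + 1 by omega]
      · rfl

lemma matE_pow_ne_zero {d n : ℕ} (hn : n < d) : matE d ^ n ≠ 0 := by
  intro h
  have := matE_pow_apply_zero (by omega) n ⟨n, hn⟩
  simp [h, Nat.factorial_ne_zero, eq_comm] at this

end Relations

section AdSubmodule

variable {d : ℕ} {X : Matrix (Fin d) (Fin d) ℂ}

lemma mem_adSubmodule_self : X ∈ adSubmodule d X :=
  Submodule.mem_sInf.mpr fun _ hW => hW.1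

lemma lie_mem_adSubmodule {A L : Matrix (Fin d) (Fin d) ℂ} (hA : A ∈ gSpan d)
    (hL : L ∈ adSubmodule d X) : ⁅A, L⁆ ∈ adSubmodule d X :=
  Submodule.mem_sInf.mpr fun W hW => hW.2 A hA L (Submodule.mem_sInf.mp hL W hW)

lemma adSubmodule_le {W : Submodule ℂ (Matrix (Fin d) (Fin d) ℂ)} (hX : X ∈ W)
    (hE : ∀ L ∈ W, ⁅matE d, L⁆ ∈ W) (hF : ∀ L ∈ W, ⁅matF d, L⁆ ∈ W)
    (hH : ∀ L ∈ W, ⁅matH d, L⁆ ∈ W) : adSubmodule d X ≤ W := by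
  refine sInf_le ⟨hX, fun A hA L hL => ?_⟩
  obtain ⟨a, b, c, rfl⟩ := Submodule.mem_span_triple.mp hA
  rw [← Ring.lie_def, add_lie, add_lie, smul_lie, smul_lie, smul_lie]
  exact W.add_mem (W.add_mem (W.smul_mem _ (hE L hL)) (W.smul_mem _ (hF L hL)))
    (W.smul_mem _ (hH L hL))

lemma matF_mem_gSpan : matF d ∈ gSpan d := Submodule.subset_span (by simp)

lemma ad_matF_pow_mem_adSubmodule (k : ℕ) :
    (LieAlgebra.ad ℂ (Matrix (Fin d) (Fin d) ℂ) (matF d) ^ k) X ∈ adSubmodule d X := by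
  induction k with
  | zero => simpa using mem_adSubmodule_self
  | succ k ih =>
    rw [pow_succ', Module.End.mul_apply]
    exact lie_mem_adSubmodule matF_mem_gSpan ih

end AdSubmodule

section Eigenspaces

/-- A multiple of the Casimir operator of the adjoint action on `d × d` matrices. -/
noncomputable def adCasimir (d : ℕ) : Module.End ℂ (Matrix (Fin d) (Fin d) ℂ) :=
  casimirOf (LieAlgebra.ad ℂ _ (matE d)) (LieAlgebra.ad ℂ _ (matF d)) (LieAlgebra.ad ℂ _ (matH d))

variable (d : ℕ)

lemma ad_matE_matF : LieAlgebra.ad ℂ _ (matE d) * LieAlgebra.ad ℂ _ (matF d) -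
    LieAlgebra.ad ℂ _ (matF d) * LieAlgebra.ad ℂ _ (matE d) = LieAlgebra.ad ℂ _ (matH d) := by
  rw [← Ring.lie_def, ← LieHom.map_lie, lie_matE_matF]

lemma ad_matH_matE : LieAlgebra.ad ℂ _ (matH d) * LieAlgebra.ad ℂ _ (matE d) -
    LieAlgebra.ad ℂ _ (matE d) * LieAlgebra.ad ℂ _ (matH d) =
      2 * LieAlgebra.ad ℂ _ (matE d) := by
  rw [← Ring.lie_def, ← LieHom.map_lie, lie_matH_matE, map_nsmul, nsmul_eq_mul, Nat.cast_ofNat]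

lemma ad_matH_matF : LieAlgebra.ad ℂ _ (matH d) * LieAlgebra.ad ℂ _ (matF d) -
    LieAlgebra.ad ℂ _ (matF d) * LieAlgebra.ad ℂ _ (matH d) =
      -(2 * LieAlgebra.ad ℂ _ (matF d)) := by
  rw [← Ring.lie_def, ← LieHom.map_lie, lie_matH_matF, map_neg, map_nsmul, nsmul_eq_mul,
    Nat.cast_ofNat]

lemma adCasimir_matE_pow (n : ℕ) :
    adCasimir d (matE d ^ n) = (4 * n * (n + 1) : ℂ) • matE d ^ n := by
  have h2 (L : Matrix (Fin d) (Fin d) ℂ) :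
      (2 : Module.End ℂ (Matrix (Fin d) (Fin d) ℂ)) L = (2 : ℂ) • L := by
    rw [two_smul, ← one_add_one_eq_two]; rfl
  simp only [adCasimir, casimirOf, LinearMap.add_apply, Module.End.mul_apply, LieAlgebra.ad_apply,
    lie_matE_matE_pow, lie_matH_matE_pow, map_zero, lie_smul, h2, smul_smul, zero_add,
    ← add_smul]
  ring_nf

lemma adSubmodule_matE_pow_le_eigenspace (n : ℕ) :
    adSubmodule d (matE d ^ n) ≤ (adCasimir d).eigenspace (4 * n * (n + 1) : ℂ) :=
  adSubmodule_le (Module.End.mem_eigenspace_iff.mpr (adCasimir_matE_pow d n))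
    (fun _ hL => Module.End.mapsTo_genEigenspace_of_comm
      (commute_casimirOf_e (ad_matE_matF d) (ad_matH_matE d)) _ 1 hL)
    (fun _ hL => Module.End.mapsTo_genEigenspace_of_comm
      (commute_casimirOf_f (ad_matE_matF d) (ad_matH_matF d)) _ 1 hL)
    (fun _ hL => Module.End.mapsTo_genEigenspace_of_comm
      (commute_casimirOf_h (ad_matH_matE d) (ad_matH_matF d)) _ 1 hL)

lemma casimir_eigenvalue_injective :
    Function.Injective fun n : Fin d => (4 * (n : ℕ) * ((n : ℕ) + 1) : ℂ) := by
  intro m n h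
  have h' : 4 * (m : ℕ) * (m + 1) = 4 * (n : ℕ) * (n + 1) := by
    simp only at h
    exact_mod_cast h
  ext
  nlinarith [h']

lemma iSupIndep_adSubmodule_matE_pow :
    iSupIndep fun n : Fin d => adSubmodule d (matE d ^ (n : ℕ)) :=
  ((adCasimir d).eigenspaces_iSupIndep.comp (casimir_eigenvalue_injective d)).mono
    fun n => adSubmodule_matE_pow_le_eigenspace d n

end Eigenspaces

section Span

variable {d : ℕ}

lemma isSl2Triple_mat (hd : 2 ≤ d) : IsSl2Triple (matH d) (matE d) (matF d) where
  h_ne_zero h := by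
    have h₀ := congr_fun₂ h ⟨0, by omega⟩ ⟨0, by omega⟩
    have h₁ : (d : ℂ) = 1 := by
      simp only [matH, of_apply, if_true, Matrix.zero_apply] at h₀
      push_cast at h₀
      linear_combination h₀
    norm_cast at h₁
    omega
  lie_e_f := lie_matE_matF d
  lie_h_e_nsmul := lie_matH_matE d
  lie_h_f_nsmul := lie_matH_matF d

lemma hasPrimitiveVectorWith_matE_pow (hd : 2 ≤ d) {n : ℕ} (hn : n < d) :
    (isSl2Triple_mat hd).HasPrimitiveVectorWith (matE d ^ n) (2 * n : ℂ) where
  ne_zero := matE_pow_ne_zero hn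
  lie_h := lie_matH_matE_pow d n
  lie_e := lie_matE_matE_pow d n

lemma linearIndependent_ad_matF_pow (hd : 2 ≤ d) {n : ℕ} (hn : n < d) :
    LinearIndependent ℂ fun k : Fin (2 * n + 1) =>
      (LieAlgebra.ad ℂ (Matrix (Fin d) (Fin d) ℂ) (matF d) ^ (k : ℕ)) (matE d ^ n) := by
  have P := hasPrimitiveVectorWith_matE_pow hd hn
  refine (LieAlgebra.ad ℂ _ (matH d)).eigenvectors_linearIndependent'
    (fun k : Fin (2 * n + 1) => (2 * n - 2 * (k : ℕ) : ℂ)) ?_ _ fun k => ?_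
  · intro k l h
    simpa [Fin.ext_iff] using h
  · exact Module.End.hasEigenvector_iff.mpr
      ⟨Module.End.mem_eigenspace_iff.mpr (P.lie_h_pow_toEnd_f k),
        P.pow_toEnd_f_ne_zero_of_eq_nat (n := 2 * n) (by push_cast; rfl) (by omega)⟩

lemma sum_two_mul_add_one (d : ℕ) : ∑ n : Fin d, (2 * (n : ℕ) + 1) = d * d := by
  induction d with
  | zero => simp
  | succ d ih => rw [Fin.sum_univ_castSucc]; simp only [Fin.val_castSucc, ih, Fin.val_last]; ring

lemma iSup_adSubmodule_matE_pow (hd : 2 ≤ d) :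
    ⨆ n : Fin d, adSubmodule d (matE d ^ (n : ℕ)) = ⊤ := by
  have hle (n : Fin d) : Submodule.span ℂ (Set.range fun k : Fin (2 * (n : ℕ) + 1) =>
      (LieAlgebra.ad ℂ (Matrix (Fin d) (Fin d) ℂ) (matF d) ^ (k : ℕ)) (matE d ^ (n : ℕ))) ≤
        adSubmodule d (matE d ^ (n : ℕ)) := by
    rw [Submodule.span_le]
    rintro _ ⟨k, rfl⟩
    exact ad_matF_pow_mem_adSubmodule k
  have hli := linearIndependent_iUnion_finite
    (fun n : Fin d => linearIndependent_ad_matF_pow hd n.isLt)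
    fun n t _ hn => ((iSupIndep_adSubmodule_matE_pow d).mono hle).disjoint_biSup hn
  have hcard : Fintype.card (Σ n : Fin d, Fin (2 * (n : ℕ) + 1)) =
      Module.finrank ℂ (Matrix (Fin d) (Fin d) ℂ) := by
    simp [Module.finrank_matrix, sum_two_mul_add_one]
  rw [eq_top_iff, ← hli.span_eq_top_of_card_eq_finrank' hcard, Submodule.span_le]
  rintro _ ⟨⟨n, k⟩, rfl⟩
  exact Submodule.mem_iSup_of_mem n (ad_matF_pow_mem_adSubmodule k)

lemma iSup_adSubmodule_matE_pow_one :
    ⨆ n : Fin 1, adSubmodule 1 (matE 1 ^ (n : ℕ)) = ⊤ := by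
  refine eq_top_iff.mpr fun L _ => Submodule.mem_iSup_of_mem 0 ?_
  have hL : L = L 0 0 • matE 1 ^ ((0 : Fin 1) : ℕ) := by
    ext i j
    simp [Subsingleton.elim i 0, Subsingleton.elim j 0]
  rw [hL]
  exact Submodule.smul_mem _ _ mem_adSubmodule_self

end Span

/-- For `n = 1, …, d` let `V_n` be the `g`-submodule of the `d×d` matrices generated
by `E^{n-1}` (here indexed by `n : Fin d`, with `V (n+1)` generated by `Eⁿ`). The
submodules `V₁, …, V_d` are independent and their sum is the whole matrix space:
the `d×d` matrices are the internal direct sum `V₁ ⊕ ⋯ ⊕ V_d`. -/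
theorem stmt9 (d : ℕ) (hd : 1 ≤ d) :
    iSupIndep (fun n : Fin d => adSubmodule d ((matE d) ^ (n : ℕ))) ∧
    (⨆ n : Fin d, adSubmodule d ((matE d) ^ (n : ℕ))) = ⊤ := by
  refine ⟨iSupIndep_adSubmodule_matE_pow d, ?_⟩
  obtain rfl | hd := hd.eq_or_lt
  · exact iSup_adSubmodule_matE_pow_one
  · exact iSup_adSubmodule_matE_pow hd
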